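/- Let T be a rectangle exchange transformation of the unit square (a piecewise translation permuting finitely many rectangles). Then T has zero Kolmogorov–Sinai entropy. More precisely, for a partition ξ into rectangles, the total boundary measure (1-dimensional Hausdorff measure of the union of atom boundaries) of the join ξ^N = ⋁_{n=0}^{N-1} T^n ξ grows at most linearly in N, which forces the number of atoms to grow subexponentially and hence H(ξ^N)/N → 0. -/

import Mathlib

open MeasureTheory Filter Topology Set

/-- The half-open unit square. -/
def unitSq : Set (ℝ × ℝ) := Set.Ico (0 : ℝ) 1 ×ˢ Set.Ico (0 : ℝ) 1

/-- A half-open rectangle. -/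
def IsRect (A : Set (ℝ × ℝ)) : Prop :=
  ∃ a b c d : ℝ, A = Set.Ico a b ×ˢ Set.Ico c d

/-- A rectangle exchange transformation of the unit square: a piecewise translation
permuting finitely many rectangles tiling the square, extended by the identity. -/
def IsRETn (n : ℕ) (T : ℝ × ℝ → ℝ × ℝ) : Prop :=
  ∃ (A : Fin n → Set (ℝ × ℝ)) (v : Fin n → ℝ × ℝ),
    (∀ i, IsRect (A i)) ∧
    Pairwise (Function.onFun Disjoint A) ∧
    (⋃ i, A i) = unitSq ∧
    (∀ i, ∀ x ∈ A i, T x = x + v i) ∧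
    Set.BijOn T unitSq unitSq ∧
    ∀ x, x ∉ unitSq → T x = x

def IsRET (T : ℝ × ℝ → ℝ × ℝ) : Prop := ∃ n, IsRETn n T

/-- A finite measurable partition of the unit square. -/
def IsPartitionSq {k : ℕ} (ξ : Fin k → Set (ℝ × ℝ)) : Prop :=
  (∀ i, MeasurableSet (ξ i)) ∧ Pairwise (Function.onFun Disjoint ξ) ∧ unitSq ⊆ ⋃ i, ξ i

/-- The Shannon entropy `H(⋁_{p=0}^{N-1} T^{-p} ξ)` of the join of iterated preimage
partitions, with respect to Lebesgue measure on the unit square. -/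
noncomputable def joinEntropyIter (T : ℝ × ℝ → ℝ × ℝ) (N : ℕ) {k : ℕ}
    (ξ : Fin k → Set (ℝ × ℝ)) : ℝ :=
  ∑ g : Fin N → Fin k,
    Real.negMulLog ((volume.restrict unitSq)
      (⋂ p : Fin N, T^[(p : ℕ)] ⁻¹' ξ (g p))).toReal

/-- The entropy of a random variable with finitely many values. -/
noncomputable def finEntropy {Ω κ : Type*} [MeasurableSpace Ω] [Fintype κ]
    (μ : Measure Ω) (X : Ω → κ) : ℝ :=
  ∑ y, Real.negMulLog (μ.real (X ⁻¹' {y}))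

/-- The first `N` symbols of the itinerary of a point under `f`, coded by `c`. -/
def itinerary {Ω κ : Type*} (f : Ω → Ω) (c : Ω → κ) (N : ℕ) (x : Ω) : Fin N → κ :=
  fun p => c (f^[p] x)

/-- Gibbs' inequality. -/
theorem sum_negMulLog_le_of_sum_le_one {ι : Type*} [Fintype ι] (p q : ι → ℝ)
    (hp : ∀ i, 0 ≤ p i) (hp1 : ∑ i, p i = 1) (hq : ∀ i, 0 ≤ q i) (hq1 : ∑ i, q i ≤ 1)
    (hpq : ∀ i, q i = 0 → p i = 0) :
    ∑ i, Real.negMulLog (p i) ≤ ∑ i, -(p i * Real.log (q i)) := by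
  have key : ∀ i, Real.negMulLog (p i) ≤ -(p i * Real.log (q i)) + (q i - p i) := by
    intro i
    rcases (hp i).eq_or_lt with h | h
    · simp [← h, hq i]
    · have hqi : 0 < q i := (hq i).lt_of_ne fun h0 => h.ne' (hpq i h0.symm)
      have h1 := Real.log_le_sub_one_of_pos (div_pos hqi h)
      rw [Real.log_div hqi.ne' h.ne'] at h1
      have h2 := mul_le_mul_of_nonneg_left h1 h.le
      rw [mul_sub, mul_sub, mul_div_cancel₀ _ h.ne'] at h2
      simp only [Real.negMulLog]
      linarith
  have := Finset.sum_le_sum fun i (_ : i ∈ Finset.univ) => key i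
  rw [Finset.sum_add_distrib, Finset.sum_sub_distrib, hp1] at this
  linarith

theorem negMulLog_sum_le {ι : Type*} [Fintype ι] (p : ι → ℝ) (hp : ∀ i, 0 ≤ p i) :
    Real.negMulLog (∑ i, p i) ≤ ∑ i, Real.negMulLog (p i) := by
  rw [Real.negMulLog, neg_mul, Finset.sum_mul, ← Finset.sum_neg_distrib]
  refine Finset.sum_le_sum fun i _ => ?_
  rcases (hp i).eq_or_lt with h | h
  · simp [← h]
  · have h1 : p i ≤ ∑ j, p j :=
      Finset.single_le_sum (fun j _ => hp j) (Finset.mem_univ i)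
    have := mul_le_mul_of_nonneg_left (Real.log_le_log h h1) h.le
    simp only [Real.negMulLog]
    linarith

/-- If the probabilities `p i` are dominated by the squares of numbers with sum at most `Z`,
their entropy is at most `2 * log Z`. -/
theorem sum_negMulLog_le_two_mul_log {ι : Type*} [Fintype ι] (p s : ι → ℝ) (Z : ℝ) (hZ : 0 < Z)
    (hp : ∀ i, 0 ≤ p i) (hp1 : ∑ i, p i = 1) (hs : ∀ i, 0 ≤ s i) (hps : ∀ i, p i ≤ s i ^ 2)
    (hsZ : ∑ i, s i ≤ Z) :
    ∑ i, Real.negMulLog (p i) ≤ 2 * Real.log Z := by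
  have h0 : ∀ i, s i = 0 → p i = 0 := fun i h =>
    le_antisymm (by simpa [h] using hps i) (hp i)
  have h1 := sum_negMulLog_le_of_sum_le_one p (fun i => s i / Z) hp hp1
    (fun i => div_nonneg (hs i) hZ.le)
    (by rw [← Finset.sum_div]; exact (div_le_one hZ).2 hsZ)
    (fun i h => h0 i ((div_eq_zero_iff.1 h).resolve_right hZ.ne'))
  have h2 : ∀ i, -(p i * Real.log (s i / Z)) ≤
      p i * Real.log Z + 1 / 2 * Real.negMulLog (p i) := by
    intro i
    rcases (hp i).eq_or_lt with h | h
    · simp [← h]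
    · have hsi : 0 < s i := (hs i).lt_of_ne fun h' => h.ne' (h0 i h'.symm)
      have h3 := mul_le_mul_of_nonneg_left (Real.log_le_log h (hps i)) h.le
      rw [Real.log_pow] at h3
      rw [Real.log_div hsi.ne' hZ.ne', Real.negMulLog]
      push_cast at h3
      linarith
  have h3 := Finset.sum_le_sum fun i (_ : i ∈ Finset.univ) => h2 i
  rw [Finset.sum_add_distrib, ← Finset.sum_mul, hp1, ← Finset.mul_sum] at h3
  linarith

theorem finEntropy_nonneg {Ω κ : Type*} [MeasurableSpace Ω] [Fintype κ]
    (μ : Measure Ω) [IsProbabilityMeasure μ] (X : Ω → κ) : 0 ≤ finEntropy μ X :=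
  Finset.sum_nonneg fun _ _ => Real.negMulLog_nonneg measureReal_nonneg measureReal_le_one

theorem measurable_itinerary {Ω κ : Type*} [MeasurableSpace Ω] [MeasurableSpace κ]
    {f : Ω → Ω} (hf : Measurable f) {c : Ω → κ} (hc : Measurable c) (N : ℕ) :
    Measurable (itinerary f c N) :=
  measurable_pi_lambda _ fun p => hc.comp (hf.iterate p)

theorem sum_measureReal_fiber {Ω κ : Type*} [MeasurableSpace Ω] [Fintype κ] [MeasurableSpace κ]
    [MeasurableSingletonClass κ] (μ : Measure Ω) [IsFiniteMeasure μ] {X : Ω → κ}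
    (hX : Measurable X) (s : Finset κ) :
    ∑ y ∈ s, μ.real (X ⁻¹' {y}) = μ.real (X ⁻¹' s) :=
  sum_measureReal_preimage_singleton s fun y _ => hX (measurableSet_singleton y)

/-- Comparison of the entropies of two codings, one of which is a function of the other up to a
set of small measure. -/
theorem finEntropy_itinerary_le {Ω κ ι : Type*} [MeasurableSpace Ω]
    [Fintype κ] [MeasurableSpace κ] [MeasurableSingletonClass κ]
    [Fintype ι] [MeasurableSpace ι] [MeasurableSingletonClass ι]
    (μ : Measure Ω) [IsProbabilityMeasure μ] {f : Ω → Ω} (hf : MeasurePreserving f μ μ)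
    {c : Ω → κ} (hc : Measurable c) {a : Ω → ι} (ha : Measurable a) (e : ι → κ)
    {r s : ℝ} (hr : 0 < r) (hr1 : r ≤ 1) (hs : 0 < s)
    (hrs : r + Fintype.card κ * s ≤ 1) (N : ℕ) :
    finEntropy μ (itinerary f c N) ≤ finEntropy μ (itinerary f a N) +
      N * (-Real.log r + -Real.log s * μ.real {x | c x ≠ e (a x)}) := by
  classical
  set G := itinerary f c N with hG
  set H := itinerary f a N with hH
  have hGm : Measurable G := measurable_itinerary hf.measurable hc N
  have hHm : Measurable H := measurable_itinerary hf.measurable ha N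
  have hΦm : Measurable fun x => (G x, H x) := hGm.prodMk hHm
  set P : (Fin N → κ) × (Fin N → ι) → ℝ := fun z => μ.real ((fun x => (G x, H x)) ⁻¹' {z}) with hP
  set K : ι → κ → ℝ := fun j i => if i = e j then r else s with hK
  have hKpos : ∀ j i, 0 < K j i := fun j i => by simp only [hK]; split_ifs <;> assumption
  have hKsum : ∀ j, ∑ i, K j i ≤ 1 := by
    intro j
    calc ∑ i, K j i ≤ ∑ i, ((if i = e j then r else 0) + s) := by
          refine Finset.sum_le_sum fun i _ => ?_
          simp only [hK]; split_ifs <;> linarith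
      _ = r + Fintype.card κ * s := by simp [Finset.sum_add_distrib]
      _ ≤ 1 := hrs
  set q : (Fin N → κ) × (Fin N → ι) → ℝ :=
    fun z => μ.real (H ⁻¹' {z.2}) * ∏ p, K (z.2 p) (z.1 p) with hq
  have hPnn : ∀ z, 0 ≤ P z := fun z => measureReal_nonneg
  have hP1 : ∑ z, P z = 1 := by
    have := sum_measureReal_fiber μ hΦm Finset.univ
    simpa using this
  have hPG : ∀ g, ∑ h, P (g, h) = μ.real (G ⁻¹' {g}) := by
    intro g
    have := sum_measureReal_fiber μ hΦm ({g} ×ˢ Finset.univ)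
    rw [Finset.sum_product, Finset.sum_singleton] at this
    rw [this]
    congr 1
    ext x
    simp [eq_comm]
  have hPH : ∀ h, ∑ g, P (g, h) = μ.real (H ⁻¹' {h}) := by
    intro h
    have := sum_measureReal_fiber μ hΦm (Finset.univ ×ˢ {h})
    rw [Finset.sum_product] at this
    simp only [Finset.sum_singleton] at this
    rw [this]
    congr 1
    ext x
    simp [eq_comm]
  have hPle : ∀ z, P z ≤ μ.real (H ⁻¹' {z.2}) := by
    rintro ⟨g, h⟩
    rw [← hPH]
    exact Finset.single_le_sum (f := fun g => P (g, h)) (fun g _ => hPnn _) (Finset.mem_univ g)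
  have hprod : ∀ z : (Fin N → κ) × (Fin N → ι), 0 < ∏ p, K (z.2 p) (z.1 p) :=
    fun z => Finset.prod_pos fun p _ => hKpos _ _
  have hq1 : ∑ z, q z ≤ 1 := by
    rw [Fintype.sum_prod_type_right]
    calc ∑ h, ∑ g, q (g, h) ≤ ∑ h, μ.real (H ⁻¹' {h}) := by
          refine Finset.sum_le_sum fun h _ => ?_
          simp only [hq]
          rw [← Finset.mul_sum, ← Fintype.prod_sum]
          exact mul_le_of_le_one_right measureReal_nonneg
            (Finset.prod_le_one (fun p _ => Finset.sum_nonneg fun i _ => (hKpos _ _).le)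
              fun p _ => hKsum _)
      _ = 1 := by
          have := sum_measureReal_fiber μ hHm Finset.univ
          simpa using this
  have gibbs := sum_negMulLog_le_of_sum_le_one P q hPnn hP1
    (fun z => mul_nonneg measureReal_nonneg (hprod z).le) hq1 (fun z hz => by
      have h0 := (mul_eq_zero.1 hz).resolve_right (hprod z).ne'
      exact le_antisymm (h0 ▸ hPle z) (hPnn z))
  have hterm : ∀ z, -(P z * Real.log (q z)) ≤ -(P z * Real.log (μ.real (H ⁻¹' {z.2}))) +
      ∑ p, (P z * -Real.log r + -Real.log s * (if z.1 p ≠ e (z.2 p) then P z else 0)) := by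
    intro z
    rcases (hPnn z).eq_or_lt with h | h
    · simp [← h]
    · have hHpos : 0 < μ.real (H ⁻¹' {z.2}) := h.trans_le (hPle z)
      simp only [hq]
      rw [Real.log_mul hHpos.ne' (hprod z).ne', Real.log_prod fun p _ => (hKpos _ _).ne',
        mul_add, neg_add, Finset.mul_sum, ← Finset.sum_neg_distrib]
      gcongr with p
      have hlr := Real.log_nonpos hr.le hr1
      simp only [hK, ite_not]
      split_ifs
      · simp
      · nlinarith
  have hbad : ∀ p : Fin N, ∑ z : (Fin N → κ) × (Fin N → ι),
      (if z.1 p ≠ e (z.2 p) then P z else 0) = μ.real {x | c x ≠ e (a x)} := by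
    intro p
    rw [← Finset.sum_filter, sum_measureReal_fiber μ hΦm]
    have hm : MeasurableSet {x | c x ≠ e (a x)} :=
      (measurableSet_eq_fun hc ((measurable_of_countable e).comp ha)).compl
    rw [← (hf.iterate p).measureReal_preimage hm.nullMeasurableSet]
    congr 1
    ext x
    simp [hG, hH, itinerary]
  calc finEntropy μ G = ∑ g, Real.negMulLog (∑ h, P (g, h)) := by
        simp only [finEntropy, hPG]
    _ ≤ ∑ g, ∑ h, Real.negMulLog (P (g, h)) :=
        Finset.sum_le_sum fun g _ => negMulLog_sum_le _ fun h => hPnn _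
    _ = ∑ z, Real.negMulLog (P z) :=
        (Fintype.sum_prod_type fun z => Real.negMulLog (P z)).symm
    _ ≤ _ := gibbs
    _ ≤ _ := Finset.sum_le_sum fun z _ => hterm z
    _ = _ := by
        rw [Finset.sum_add_distrib, Finset.sum_comm (s := Finset.univ (α := _ × _))]
        simp only [Finset.sum_add_distrib, ← Finset.mul_sum, ← Finset.sum_mul, hP1, hbad]
        rw [Fintype.sum_prod_type_right]
        simp only [Finset.sum_neg_distrib, ← Finset.sum_mul, hPH]
        simp only [finEntropy, Real.negMulLog, neg_mul, Finset.sum_neg_distrib,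
          Finset.sum_const, Finset.card_univ, Fintype.card_fin, nsmul_eq_mul]
        ring

theorem IsRect.measurableSet {A : Set (ℝ × ℝ)} (hA : IsRect A) : MeasurableSet A := by
  obtain ⟨a, b, c, d, rfl⟩ := hA
  exact measurableSet_Ico.prod measurableSet_Ico

theorem IsRect.inter {A B : Set (ℝ × ℝ)} (hA : IsRect A) (hB : IsRect B) : IsRect (A ∩ B) := by
  obtain ⟨a, b, c, d, rfl⟩ := hA
  obtain ⟨a', b', c', d', rfl⟩ := hB
  exact ⟨a ⊔ a', b ⊓ b', c ⊔ c', d ⊓ d', by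
    rw [Set.prod_inter_prod, Set.Ico_inter_Ico, Set.Ico_inter_Ico]⟩

theorem IsRect.preimage_add {A : Set (ℝ × ℝ)} (hA : IsRect A) (v : ℝ × ℝ) :
    IsRect ((· + v) ⁻¹' A) := by
  obtain ⟨a, b, c, d, rfl⟩ := hA
  refine ⟨a - v.1, b - v.1, c - v.2, d - v.2, ?_⟩
  ext x
  simp [lt_sub_iff_add_lt]

theorem IsRect.image_add {A : Set (ℝ × ℝ)} (hA : IsRect A) (v : ℝ × ℝ) :
    IsRect ((· + v) '' A) := by
  simpa [Set.image_add_right] using hA.preimage_add (-v)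

theorem IsRect.preimage_swap {A : Set (ℝ × ℝ)} (hA : IsRect A) :
    IsRect (Prod.swap ⁻¹' A) := by
  obtain ⟨a, b, c, d, rfl⟩ := hA
  exact ⟨c, d, a, b, by rw [Set.preimage_swap_prod]⟩

theorem isRect_unitSq : IsRect unitSq := ⟨0, 1, 0, 1, rfl⟩

theorem volume_unitSq : volume unitSq = 1 := by
  simp [unitSq, Measure.volume_eq_prod, Measure.prod_prod]

instance isProbabilityMeasure_restrict_unitSq :
    IsProbabilityMeasure (volume.restrict unitSq) :=
  ⟨by rw [Measure.restrict_apply_univ, volume_unitSq]⟩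

theorem sum_measure_le_of_disjoint {α ι : Type*} [MeasurableSpace α] [Fintype ι] (μ : Measure α)
    {S : ι → Set α} {U : Set α} (hm : ∀ i, MeasurableSet (S i))
    (hd : Pairwise (Function.onFun Disjoint S)) (hU : ∀ i, S i ⊆ U) : ∑ i, μ (S i) ≤ μ U := by
  rw [← tsum_fintype (L := .unconditional _)]
  exact (tsum_meas_le_meas_iUnion_of_disjoint μ hm hd).trans
    (measure_mono (Set.iUnion_subset hU))

/-- Cutting disjoint rectangles `R h` along disjoint rectangles `B i` in the unit square
increases the total width by at most the number of the `B i`: each vertical line meets a piece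
either on the bottom side of its `R h` or on the bottom side of its `B i`. -/
theorem sum_width_inter_le {ι κ : Type*} [Fintype ι] [Fintype κ]
    {R : κ → Set (ℝ × ℝ)} {B : ι → Set (ℝ × ℝ)}
    (hR : ∀ h, IsRect (R h)) (hRd : Pairwise (Function.onFun Disjoint R))
    (hB : ∀ i, IsRect (B i)) (hBd : Pairwise (Function.onFun Disjoint B))
    (hBu : ∀ i, B i ⊆ unitSq) :
    ∑ h, ∑ i, volume (Prod.fst '' (B i ∩ R h)) ≤
      ∑ h, volume (Prod.fst '' R h) + Fintype.card ι := by
  have hmeas : ∀ h i, MeasurableSet (B i ∩ R h) := fun h i =>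
    (hB i).measurableSet.inter (hR h).measurableSet
  choose a b c d hR' using hR
  choose a' b' c' d' hB' using hB
  have hline : ∀ (S : Set (ℝ × ℝ)) (y : ℝ), MeasurableSet S →
      MeasurableSet ((fun x : ℝ => (x, y)) ⁻¹' S) := fun S y hS =>
    (measurable_id.prodMk measurable_const) hS
  have hsub : ∀ h i, Prod.fst '' (B i ∩ R h) ⊆
      ((fun x => (x, c h)) ⁻¹' (B i ∩ R h)) ∪ ((fun x => (x, c' i)) ⁻¹' (B i ∩ R h)) := by
    rintro h i _ ⟨⟨x, y⟩, ⟨hxB, hxR⟩, rfl⟩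
    simp only [hB', hR', Set.mem_union, Set.mem_preimage, Set.mem_inter_iff, Set.mem_prod,
      Set.mem_Ico] at hxB hxR ⊢
    rcases le_total (c' i) (c h) with hc | hc
    · exact Or.inl ⟨⟨hxB.1, hc, hxR.2.1.trans_lt hxB.2.2⟩, hxR.1, le_rfl,
        hxR.2.1.trans_lt hxR.2.2⟩
    · exact Or.inr ⟨⟨hxB.1, le_rfl, hxB.2.1.trans_lt hxB.2.2⟩, hxR.1, hc,
        hxB.2.1.trans_lt hxR.2.2⟩
  have hF : ∀ h, ∑ i, volume ((fun x => (x, c h)) ⁻¹' (B i ∩ R h)) ≤ volume (Prod.fst '' R h) := by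
    intro h
    refine sum_measure_le_of_disjoint _ (fun i => hline _ _ (hmeas h i)) ?_ ?_
    · exact fun i j hij =>
        ((hBd hij).mono Set.inter_subset_left Set.inter_subset_left).preimage _
    · exact fun i x hx => ⟨_, hx.2, rfl⟩
  have hE : ∀ i, ∑ h, volume ((fun x => (x, c' i)) ⁻¹' (B i ∩ R h)) ≤ 1 := by
    intro i
    have h1 : volume (Set.Ico (0 : ℝ) 1) = 1 := by simp
    rw [← h1]
    refine sum_measure_le_of_disjoint _ (fun h => hline _ _ (hmeas h i)) ?_ ?_
    · exact fun h h' hij =>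
        ((hRd hij).mono Set.inter_subset_right Set.inter_subset_right).preimage _
    · exact fun h x hx => (hBu i hx.1).1
  calc ∑ h, ∑ i, volume (Prod.fst '' (B i ∩ R h))
      ≤ ∑ h, ∑ i, (volume ((fun x => (x, c h)) ⁻¹' (B i ∩ R h)) +
          volume ((fun x => (x, c' i)) ⁻¹' (B i ∩ R h))) := by
        gcongr with h _ i _
        exact (measure_mono (hsub h i)).trans (measure_union_le _ _)
    _ = ∑ h, ∑ i, volume ((fun x => (x, c h)) ⁻¹' (B i ∩ R h)) +
          ∑ i, ∑ h, volume ((fun x => (x, c' i)) ⁻¹' (B i ∩ R h)) := by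
        simp only [Finset.sum_add_distrib]
        rw [Finset.sum_comm (f := fun h i => volume ((fun x => (x, c' i)) ⁻¹' (B i ∩ R h)))]
    _ ≤ ∑ h, volume (Prod.fst '' R h) + ∑ _i : ι, 1 := by
        gcongr with h _ i _
        · exact hF h
        · exact hE i
    _ = _ := by simp

/-- The version of `sum_width_inter_le` for heights. -/
theorem sum_height_inter_le {ι κ : Type*} [Fintype ι] [Fintype κ]
    {R : κ → Set (ℝ × ℝ)} {B : ι → Set (ℝ × ℝ)}
    (hR : ∀ h, IsRect (R h)) (hRd : Pairwise (Function.onFun Disjoint R))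
    (hB : ∀ i, IsRect (B i)) (hBd : Pairwise (Function.onFun Disjoint B))
    (hBu : ∀ i, B i ⊆ unitSq) :
    ∑ h, ∑ i, volume (Prod.snd '' (B i ∩ R h)) ≤
      ∑ h, volume (Prod.snd '' R h) + Fintype.card ι := by
  have hsnd : ∀ S : Set (ℝ × ℝ), Prod.fst '' (Prod.swap ⁻¹' S) = Prod.snd '' S := by
    intro S
    ext y
    simp
  have := sum_width_inter_le (fun h => (hR h).preimage_swap)
    (fun h h' hh => (hRd hh).preimage Prod.swap) (fun i => (hB i).preimage_swap)
    (fun i j hij => (hBd hij).preimage Prod.swap)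
    (fun i x hx => ⟨(hBu i hx).2, (hBu i hx).1⟩)
  simpa only [← Set.preimage_inter, hsnd] using this

/-- `T` exchanges the rectangles `A i`, translating `A i` by `v i`. -/
structure IsRectExchange {ι : Type*} (T : ℝ × ℝ → ℝ × ℝ) (A : ι → Set (ℝ × ℝ))
    (v : ι → ℝ × ℝ) : Prop where
  isRect : ∀ i, IsRect (A i)
  disjoint : Pairwise (Function.onFun Disjoint A)
  iUnion_eq : (⋃ i, A i) = unitSq
  map_eq : ∀ i, ∀ x ∈ A i, T x = x + v i
  bijOn : Set.BijOn T unitSq unitSq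
  map_eq_self : ∀ x, x ∉ unitSq → T x = x

namespace IsRectExchange

variable {ι : Type*} {T : ℝ × ℝ → ℝ × ℝ} {A : ι → Set (ℝ × ℝ)} {v : ι → ℝ × ℝ}

theorem subset_unitSq (hT : IsRectExchange T A v) (i : ι) : A i ⊆ unitSq :=
  hT.iUnion_eq ▸ Set.subset_iUnion A i

theorem image_eq (hT : IsRectExchange T A v) (i : ι) : T '' A i = (· + v i) '' A i :=
  Set.image_congr (hT.map_eq i)

theorem isRect_image (hT : IsRectExchange T A v) (i : ι) : IsRect (T '' A i) :=
  hT.image_eq i ▸ (hT.isRect i).image_add (v i)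

theorem disjoint_image (hT : IsRectExchange T A v) :
    Pairwise (Function.onFun Disjoint fun i => T '' A i) := fun _ _ hij =>
  (hT.disjoint hij).image hT.bijOn.injOn (hT.subset_unitSq _) (hT.subset_unitSq _)

theorem image_subset (hT : IsRectExchange T A v) (i : ι) : T '' A i ⊆ unitSq :=
  (Set.image_mono (hT.subset_unitSq i)).trans hT.bijOn.image_eq.subset

theorem image_inter_eq (hT : IsRectExchange T A v) (i : ι) (S : Set (ℝ × ℝ)) :
    T '' A i ∩ S = (· + v i) '' (A i ∩ T ⁻¹' S) := by
  rw [← Set.image_inter_preimage]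
  exact Set.image_congr fun x hx => hT.map_eq i x hx.1

theorem iUnion_image_eq (hT : IsRectExchange T A v) : ⋃ i, T '' A i = unitSq := by
  rw [← Set.image_iUnion, hT.iUnion_eq, hT.bijOn.image_eq]

theorem measurable [Finite ι] (hT : IsRectExchange T A v) : Measurable T := by
  intro S hS
  have : T ⁻¹' S = (⋃ i, A i ∩ (· + v i) ⁻¹' S) ∪ (unitSqᶜ ∩ S) := by
    ext x
    by_cases hx : x ∈ unitSq
    · obtain ⟨i, hi⟩ := Set.mem_iUnion.1 (hT.iUnion_eq.symm ▸ hx)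
      simp only [Set.mem_preimage, Set.mem_union, Set.mem_iUnion, Set.mem_inter_iff,
        Set.mem_compl_iff, hx, not_true_eq_false, false_and, or_false]
      refine ⟨fun h => ⟨i, hi, hT.map_eq i x hi ▸ h⟩, ?_⟩
      rintro ⟨j, hj, h⟩
      rwa [hT.map_eq j x hj]
    · have h1 : ∀ i, x ∉ A i := fun i hi => hx (hT.subset_unitSq i hi)
      simp [hx, h1, hT.map_eq_self x hx]
  rw [this]
  exact (MeasurableSet.iUnion fun i => (hT.isRect i).measurableSet.inter
    (measurable_add_const _ hS)).union (isRect_unitSq.measurableSet.compl.inter hS)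

theorem measurePreserving [Finite ι] (hT : IsRectExchange T A v) :
    MeasurePreserving T (volume.restrict unitSq) (volume.restrict unitSq) := by
  refine ⟨hT.measurable, Measure.ext fun S hS => ?_⟩
  have hTS := hT.measurable hS
  rw [Measure.map_apply hT.measurable hS, Measure.restrict_apply hTS, Measure.restrict_apply hS]
  have h1 : T ⁻¹' S ∩ unitSq = ⋃ i, A i ∩ T ⁻¹' S := by
    rw [← Set.iUnion_inter, hT.iUnion_eq, Set.inter_comm]
  have h2 : S ∩ unitSq = ⋃ i, T '' A i ∩ S := by
    rw [← Set.iUnion_inter, hT.iUnion_image_eq, Set.inter_comm]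
  rw [h1, h2, measure_iUnion, measure_iUnion]
  · congr 1
    ext i
    rw [hT.image_inter_eq, Set.image_add_right, measure_preimage_add_right]
  · exact fun i j hij =>
      (hT.disjoint_image hij).mono Set.inter_subset_left Set.inter_subset_left
  · exact fun i => (hT.isRect_image i).measurableSet.inter hS
  · exact fun i j hij => (hT.disjoint hij).mono Set.inter_subset_left Set.inter_subset_left
  · exact fun i => (hT.isRect i).measurableSet.inter hTS

end IsRectExchange

/-- The points of the unit square whose first `N` iterates visit the sets `A (h p)`. -/
def rectCylinder {ι : Type*} (T : ℝ × ℝ → ℝ × ℝ) (A : ι → Set (ℝ × ℝ)) (N : ℕ) (h : Fin N → ι) :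
    Set (ℝ × ℝ) :=
  unitSq ∩ {x | ∀ p : Fin N, T^[p] x ∈ A (h p)}

namespace IsRectExchange

variable {ι : Type*} {T : ℝ × ℝ → ℝ × ℝ} {A : ι → Set (ℝ × ℝ)} {v : ι → ℝ × ℝ}

theorem cylinder_cons (hT : IsRectExchange T A v) (N : ℕ) (i : ι) (h : Fin N → ι) :
    rectCylinder T A (N + 1) (Fin.cons i h) = A i ∩ T ⁻¹' rectCylinder T A N h := by
  ext x
  simp only [rectCylinder, Set.mem_inter_iff, Set.mem_ofPred_eq, Fin.forall_fin_succ, Fin.cons_zero,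
    Fin.cons_succ, Fin.val_zero, Fin.val_succ, Function.iterate_zero, id, Set.mem_preimage,
    Function.iterate_succ_apply]
  exact ⟨fun ⟨h1, h2, h3⟩ => ⟨h2, hT.bijOn.mapsTo h1, h3⟩,
    fun ⟨h1, _, h3⟩ => ⟨hT.subset_unitSq i h1, h1, h3⟩⟩

theorem isRect_cylinder (hT : IsRectExchange T A v) :
    ∀ (N : ℕ) (h : Fin N → ι), IsRect (rectCylinder T A N h)
  | 0, h => by simpa [rectCylinder] using isRect_unitSq
  | N + 1, h => by
    rw [← Fin.cons_self_tail h, hT.cylinder_cons]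
    have : A (h 0) ∩ T ⁻¹' rectCylinder T A N (Fin.tail h) =
        A (h 0) ∩ (· + v (h 0)) ⁻¹' rectCylinder T A N (Fin.tail h) := by
      ext x
      refine and_congr_right fun hx => ?_
      rw [Set.mem_preimage, hT.map_eq _ x hx, Set.mem_preimage]
    rw [this]
    exact (hT.isRect _).inter ((hT.isRect_cylinder N _).preimage_add _)

theorem disjoint_cylinder (hT : IsRectExchange T A v) (N : ℕ) :
    Pairwise (Function.onFun Disjoint (rectCylinder T A N)) := by
  intro h h' hh
  obtain ⟨p, hp⟩ := Function.ne_iff.1 hh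
  exact Set.disjoint_left.2 fun x hx hx' =>
    Set.disjoint_left.1 (hT.disjoint hp) (hx.2 p) (hx'.2 p)

theorem sum_width_cylinder_le [Fintype ι] (hT : IsRectExchange T A v) (N : ℕ) :
    ∑ h, volume (Prod.fst '' rectCylinder T A N h) ≤ 1 + N * Fintype.card ι := by
  induction N with
  | zero =>
    have : Prod.fst '' unitSq = Set.Ico (0 : ℝ) 1 :=
      Set.fst_image_prod _ ⟨0, by simp⟩
    simp [rectCylinder, this]
  | succ N ih =>
    rw [← (Fin.consEquiv fun _ => ι).sum_comp, Fintype.sum_prod_type_right]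
    calc ∑ h, ∑ i, volume (Prod.fst '' rectCylinder T A (N + 1) (Fin.cons i h))
        = ∑ h, ∑ i, volume (Prod.fst '' (T '' A i ∩ rectCylinder T A N h)) := by
          refine Finset.sum_congr rfl fun h _ => Finset.sum_congr rfl fun i _ => ?_
          rw [hT.cylinder_cons, hT.image_inter_eq, Set.image_image]
          simp only [Prod.fst_add]
          rw [← Set.image_image (fun y => y + (v i).1) Prod.fst, Set.image_add_right,
            measure_preimage_add_right]
      _ ≤ ∑ h, volume (Prod.fst '' rectCylinder T A N h) + Fintype.card ι :=
          sum_width_inter_le (hT.isRect_cylinder N) (hT.disjoint_cylinder N) hT.isRect_image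
            hT.disjoint_image hT.image_subset
      _ ≤ 1 + N * Fintype.card ι + Fintype.card ι := by gcongr
      _ = _ := by push_cast; ring

theorem sum_height_cylinder_le [Fintype ι] (hT : IsRectExchange T A v) (N : ℕ) :
    ∑ h, volume (Prod.snd '' rectCylinder T A N h) ≤ 1 + N * Fintype.card ι := by
  induction N with
  | zero =>
    have : Prod.snd '' unitSq = Set.Ico (0 : ℝ) 1 :=
      Set.snd_image_prod ⟨0, by simp⟩ _
    simp [rectCylinder, this]
  | succ N ih =>
    rw [← (Fin.consEquiv fun _ => ι).sum_comp, Fintype.sum_prod_type_right]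
    calc ∑ h, ∑ i, volume (Prod.snd '' rectCylinder T A (N + 1) (Fin.cons i h))
        = ∑ h, ∑ i, volume (Prod.snd '' (T '' A i ∩ rectCylinder T A N h)) := by
          refine Finset.sum_congr rfl fun h _ => Finset.sum_congr rfl fun i _ => ?_
          rw [hT.cylinder_cons, hT.image_inter_eq, Set.image_image]
          simp only [Prod.snd_add]
          rw [← Set.image_image (fun y => y + (v i).2) Prod.snd, Set.image_add_right,
            measure_preimage_add_right]
      _ ≤ ∑ h, volume (Prod.snd '' rectCylinder T A N h) + Fintype.card ι :=
          sum_height_inter_le (hT.isRect_cylinder N) (hT.disjoint_cylinder N) hT.isRect_image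
            hT.disjoint_image hT.image_subset
      _ ≤ 1 + N * Fintype.card ι + Fintype.card ι := by gcongr
      _ = _ := by push_cast; ring

/-- The entropy of the itineraries with respect to the exchanged rectangles grows at most
logarithmically. -/
theorem finEntropy_itinerary_le_log [Fintype ι] [MeasurableSpace ι] [MeasurableSingletonClass ι]
    (hT : IsRectExchange T A v) {a : ℝ × ℝ → ι} (ha : Measurable a)
    (haA : ∀ x ∈ unitSq, x ∈ A (a x)) (N : ℕ) :
    finEntropy (volume.restrict unitSq) (itinerary T a N) ≤
      2 * Real.log (1 + N * Fintype.card ι) := by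
  have hm := measurable_itinerary hT.measurable ha N
  have hfin : (1 + N * Fintype.card ι : ENNReal) ≠ ⊤ := by finiteness
  set w := fun h => volume (Prod.fst '' rectCylinder T A N h) with hw
  set l := fun h => volume (Prod.snd '' rectCylinder T A N h) with hl
  have hwfin : ∀ h, w h ≠ ⊤ := fun h => ne_top_of_le_ne_top hfin
    ((Finset.single_le_sum (f := w) (fun _ _ => zero_le) (Finset.mem_univ h)).trans
      (hT.sum_width_cylinder_le N))
  have hlfin : ∀ h, l h ≠ ⊤ := fun h => ne_top_of_le_ne_top hfin
    ((Finset.single_le_sum (f := l) (fun _ _ => zero_le) (Finset.mem_univ h)).trans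
      (hT.sum_height_cylinder_le N))
  have hwsum : ∑ h, (w h).toReal ≤ 1 + N * Fintype.card ι := by
    rw [← ENNReal.toReal_sum fun h _ => hwfin h]
    have := ENNReal.toReal_mono hfin (hT.sum_width_cylinder_le N)
    rwa [ENNReal.toReal_add (by finiteness) (by finiteness), ENNReal.toReal_mul,
      ENNReal.toReal_natCast, ENNReal.toReal_natCast, ENNReal.toReal_one] at this
  have hlsum : ∑ h, (l h).toReal ≤ 1 + N * Fintype.card ι := by
    rw [← ENNReal.toReal_sum fun h _ => hlfin h]
    have := ENNReal.toReal_mono hfin (hT.sum_height_cylinder_le N)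
    rwa [ENNReal.toReal_add (by finiteness) (by finiteness), ENNReal.toReal_mul,
      ENNReal.toReal_natCast, ENNReal.toReal_natCast, ENNReal.toReal_one] at this
  have hvol : ∀ h, (volume.restrict unitSq).real (itinerary T a N ⁻¹' {h}) ≤
      (w h).toReal * (l h).toReal := by
    intro h
    rw [← ENNReal.toReal_mul, Measure.real]
    refine ENNReal.toReal_mono (ENNReal.mul_ne_top (hwfin h) (hlfin h)) ?_
    rw [Measure.restrict_apply' isRect_unitSq.measurableSet, hw, hl, ← Measure.prod_prod,
      ← Measure.volume_eq_prod]
    refine measure_mono fun x hx => ?_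
    have hx' : x ∈ rectCylinder T A N h := by
      refine ⟨hx.2, fun p => ?_⟩
      rw [← show itinerary T a N x = h from hx.1]
      exact haA _ ((hT.bijOn.mapsTo.iterate p) hx.2)
    exact ⟨⟨x, hx', rfl⟩, ⟨x, hx', rfl⟩⟩
  refine sum_negMulLog_le_two_mul_log _ (fun h => ((w h).toReal + (l h).toReal) / 2) _
    (by positivity) (fun h => measureReal_nonneg) ?_ (fun h => by positivity) (fun h => ?_) ?_
  · have := sum_measureReal_fiber (volume.restrict unitSq) hm Finset.univ
    simpa using this
  · nlinarith [hvol h, sq_nonneg ((w h).toReal - (l h).toReal)]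
  · rw [← Finset.sum_div, Finset.sum_add_distrib]
    linarith

/-- A rectangle exchange also exchanges arbitrarily small rectangles. -/
theorem exists_refinement (hT : IsRectExchange T A v) (m : ℕ) (hm : 0 < m) :
    ∃ D : ι × Fin m × Fin m → Set (ℝ × ℝ), IsRectExchange T D (fun j => v j.1) ∧
      ∀ j, ∀ x ∈ D j, ∀ y ∈ D j, dist x y < 1 / m := by
  have hm' : (0 : ℝ) < m := by exact_mod_cast hm
  have hcell : ∀ (b : Fin m) (t : ℝ),
      t ∈ Set.Ico ((b : ℝ) / m) (((b : ℝ) + 1) / m) → ⌊t * m⌋₊ = b := by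
    rintro b t ⟨h1, h2⟩
    rw [div_le_iff₀ hm'] at h1
    rw [lt_div_iff₀ hm'] at h2
    exact (Nat.floor_eq_iff (b.val.cast_nonneg.trans h1)).2 ⟨h1, h2⟩
  have hdist : ∀ (b : Fin m) (s t : ℝ), s ∈ Set.Ico ((b : ℝ) / m) (((b : ℝ) + 1) / m) →
      t ∈ Set.Ico ((b : ℝ) / m) (((b : ℝ) + 1) / m) → dist s t < 1 / m := by
    rintro b s t ⟨h1, h2⟩ ⟨h3, h4⟩
    rw [add_div] at h2 h4
    rw [Real.dist_eq, abs_lt]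
    constructor <;> linarith
  have hex : ∀ t : ℝ, 0 ≤ t → t < 1 →
      ∃ b : Fin m, t ∈ Set.Ico ((b : ℝ) / m) (((b : ℝ) + 1) / m) := by
    intro t h0 h1
    refine ⟨⟨⌊t * m⌋₊, ?_⟩, ?_, ?_⟩
    · rw [Nat.floor_lt (by positivity)]
      nlinarith
    · rw [div_le_iff₀ hm']
      exact Nat.floor_le (by positivity)
    · rw [lt_div_iff₀ hm']
      exact Nat.lt_floor_add_one _
  refine ⟨fun j => A j.1 ∩ Set.Ico ((j.2.1 : ℝ) / m) (((j.2.1 : ℝ) + 1) / m) ×ˢ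
    Set.Ico ((j.2.2 : ℝ) / m) (((j.2.2 : ℝ) + 1) / m),
    ⟨fun j => (hT.isRect _).inter ⟨_, _, _, _, rfl⟩, ?_, ?_, fun j x hx => hT.map_eq _ x hx.1,
      hT.bijOn, hT.map_eq_self⟩, ?_⟩
  · rintro ⟨i, b, b'⟩ ⟨j, d, d'⟩ hne
    refine Set.disjoint_left.2 fun x hx hx' => hne ?_
    have h1 : i = j := by
      by_contra hij
      exact Set.disjoint_left.1 (hT.disjoint hij) hx.1 hx'.1
    have h2 : b = d := Fin.ext ((hcell b _ hx.2.1).symm.trans (hcell d _ hx'.2.1))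
    have h3 : b' = d' := Fin.ext ((hcell b' _ hx.2.2).symm.trans (hcell d' _ hx'.2.2))
    rw [h1, h2, h3]
  · refine Set.Subset.antisymm
      (Set.iUnion_subset fun j => Set.inter_subset_left.trans (hT.subset_unitSq _)) fun x hx => ?_
    obtain ⟨i, hi⟩ := Set.mem_iUnion.1 (hT.iUnion_eq.symm ▸ hx)
    obtain ⟨b, hb⟩ := hex x.1 hx.1.1 hx.1.2
    obtain ⟨d, hd⟩ := hex x.2 hx.2.1 hx.2.2
    exact Set.mem_iUnion.2 ⟨(i, b, d), hi, hb, hd⟩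
  · rintro j x ⟨_, hx⟩ y ⟨_, hy⟩
    exact max_lt (hdist _ _ _ hx.1 hy.1) (hdist _ _ _ hx.2 hy.2)

end IsRectExchange

/-- A measurable coding map for a finite measurable partition of the unit square. -/
theorem exists_measurable_code {ι : Type*} [Finite ι] [Nonempty ι] [MeasurableSpace ι]
    {D : ι → Set (ℝ × ℝ)} (hm : ∀ i, MeasurableSet (D i))
    (hd : Pairwise (Function.onFun Disjoint D)) (hc : unitSq ⊆ ⋃ i, D i) :
    ∃ c : ℝ × ℝ → ι, Measurable c ∧ ∀ x ∈ unitSq, ∀ i, x ∈ D i ↔ c x = i := by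
  obtain ⟨c, hcm, h⟩ := exists_measurable_piecewise D hm (fun i _ => i)
    (fun i => measurable_const)
    (fun i j hij x hx => (Set.disjoint_left.1 (hd hij) hx.1 hx.2).elim)
  refine ⟨c, hcm, fun x hx i => ⟨fun hi => h i hi, ?_⟩⟩
  rintro rfl
  obtain ⟨j, hj⟩ := Set.mem_iUnion.1 (hc hx)
  rwa [show c x = j from h j hj]

/-- A finite measurable partition of the unit square is a function of any sufficiently fine
partition, up to a set of small measure. -/
theorem exists_fine_code {κ : Type*} [Fintype κ] [Nonempty κ] [MeasurableSpace κ]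
    [MeasurableSingletonClass κ] {c : ℝ × ℝ → κ} (hc : Measurable c) {ε : ℝ} (hε : 0 < ε) :
    ∃ δ > 0, ∀ {ι : Type} (a : ℝ × ℝ → ι),
      (∀ x ∈ unitSq, ∀ y ∈ unitSq, a x = a y → dist x y < δ) →
        ∃ e : ι → κ, (volume.restrict unitSq).real {x | c x ≠ e (a x)} ≤ ε := by
  classical
  have hS : ∀ i, MeasurableSet (c ⁻¹' {i} ∩ unitSq) := fun i =>
    (hc (measurableSet_singleton i)).inter isRect_unitSq.measurableSet
  have hSfin : ∀ i, volume (c ⁻¹' {i} ∩ unitSq) ≠ ⊤ := fun i =>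
    ne_top_of_le_ne_top (by rw [volume_unitSq]; exact ENNReal.one_ne_top)
      (measure_mono Set.inter_subset_right)
  have hcard : (0 : ℝ) < Fintype.card κ := by exact_mod_cast Fintype.card_pos
  have hε' : ENNReal.ofReal (ε / Fintype.card κ) ≠ 0 := by
    rw [Ne, ENNReal.ofReal_eq_zero, not_le]
    positivity
  choose K hKS hKc hKμ using fun i =>
    (hS i).exists_isCompact_sdiff_lt (hSfin i) hε'
  have hev : ∀ i j, ∀ᶠ δ in 𝓝[>] (0 : ℝ), i ≠ j →
      Disjoint (Metric.thickening δ (K i)) (Metric.thickening δ (K j)) := by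
    intro i j
    by_cases hij : i = j
    · simp [hij]
    · have hd : Disjoint (K i) (K j) := Set.disjoint_left.2 fun x hx hx' =>
        hij ((hKS i hx).1.symm.trans (hKS j hx').1)
      obtain ⟨δ, hδ, h⟩ := hd.exists_thickenings (hKc i) (hKc j).isClosed
      filter_upwards [Ioc_mem_nhdsGT hδ] with r hr _
      exact h.mono (Metric.thickening_mono hr.2 _) (Metric.thickening_mono hr.2 _)
  obtain ⟨δ, hδ, hδ0⟩ := ((eventually_all.2 fun i => eventually_all.2 fun j => hev i j).and
    self_mem_nhdsWithin).exists
  refine ⟨δ, hδ0, fun {ι} a ha => ?_⟩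
  have he : ∀ j : ι, ∃ i : κ, ∀ x ∈ unitSq, a x = j → x ∈ K (c x) → c x = i := by
    intro j
    by_cases hj : ∃ y ∈ unitSq, a y = j ∧ y ∈ K (c y)
    · obtain ⟨y, hy, rfl, hyK⟩ := hj
      refine ⟨c y, fun x hx hxy hxK => ?_⟩
      by_contra hne
      refine Set.disjoint_left.1 (hδ _ _ hne) (Metric.self_subset_thickening hδ0 _ hxK)
        (Metric.mem_thickening_iff.2 ⟨y, hyK, ha x hx y hy hxy⟩)
    · exact ⟨Classical.arbitrary κ, fun x hx hxj hxK => (hj ⟨x, hx, hxj, hxK⟩).elim⟩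
  choose e he using he
  refine ⟨e, ?_⟩
  rw [Measure.real, Measure.restrict_apply' isRect_unitSq.measurableSet]
  refine ENNReal.toReal_le_of_le_ofReal hε.le ?_
  calc volume ({x | c x ≠ e (a x)} ∩ unitSq)
      ≤ volume (⋃ i, (c ⁻¹' {i} ∩ unitSq) \ K i) := by
        refine measure_mono fun x hx => Set.mem_iUnion.2 ⟨c x, ⟨rfl, hx.2⟩, fun hxK => ?_⟩
        exact hx.1 (he _ x hx.2 rfl hxK)
    _ ≤ ∑ i, volume ((c ⁻¹' {i} ∩ unitSq) \ K i) := measure_iUnion_fintype_le _ _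
    _ ≤ ∑ _i : κ, ENNReal.ofReal (ε / Fintype.card κ) :=
        Finset.sum_le_sum fun i _ => (hKμ i).le
    _ = ENNReal.ofReal ε := by
        rw [Finset.sum_const, Finset.card_univ, ← ENNReal.ofReal_nsmul, nsmul_eq_mul,
          mul_div_cancel₀ _ hcard.ne']

theorem tendsto_two_mul_log_one_add_mul_div (C : ℝ) (hC : 0 ≤ C) :
    Tendsto (fun N : ℕ => 2 * Real.log (1 + N * C) / N) atTop (𝓝 0) := by
  have h1 : Tendsto (fun N : ℕ => Real.log N / N) atTop (𝓝 0) :=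
    Real.isLittleO_log_id_atTop.tendsto_div_nhds_zero.comp tendsto_natCast_atTop_atTop
  have h2 : Tendsto (fun N : ℕ => Real.log (1 + C) / N) atTop (𝓝 0) :=
    tendsto_const_div_atTop_nhds_zero_nat _
  have h3 : Tendsto (fun N : ℕ => 2 * (Real.log (1 + C) / N + Real.log N / N)) atTop (𝓝 0) := by
    simpa using (h2.add h1).const_mul 2
  refine squeeze_zero' (Eventually.of_forall fun N => ?_) ?_ h3
  · have : 0 ≤ Real.log (1 + N * C) := Real.log_nonneg (by nlinarith [N.cast_nonneg (α := ℝ)])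
    positivity
  · filter_upwards [eventually_ge_atTop 1] with N hN
    have hN' : (1 : ℝ) ≤ N := by exact_mod_cast hN
    rw [← add_div, ← Real.log_mul (by positivity) (by positivity), mul_div_assoc]
    gcongr
    nlinarith

theorem joinEntropyIter_eq_finEntropy {T : ℝ × ℝ → ℝ × ℝ} (hT : Set.MapsTo T unitSq unitSq)
    {k : ℕ} {ξ : Fin k → Set (ℝ × ℝ)} {c : ℝ × ℝ → Fin k}
    (hc : ∀ x ∈ unitSq, ∀ i, x ∈ ξ i ↔ c x = i) (N : ℕ) :
    joinEntropyIter T N ξ = finEntropy (volume.restrict unitSq) (itinerary T c N) := by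
  refine Finset.sum_congr rfl fun g _ => ?_
  rw [Measure.real, Measure.restrict_apply' isRect_unitSq.measurableSet,
    Measure.restrict_apply' isRect_unitSq.measurableSet]
  congr 3
  ext x
  refine and_congr_left fun hx => ?_
  simp only [Set.mem_iInter, Set.mem_preimage, Set.mem_singleton_iff, funext_iff, itinerary]
  exact forall_congr' fun p => hc _ ((hT.iterate p) hx) _

/-- a rectangle exchange transformation of the unit square has zero
Kolmogorov–Sinai entropy: `H(ξ^N)/N → 0` for every finite measurable partition `ξ`. -/
theorem rectangle_exchange_zero_entropy
    (T : ℝ × ℝ → ℝ × ℝ) (hT : IsRET T) :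
    ∀ (k : ℕ) (ξ : Fin k → Set (ℝ × ℝ)), IsPartitionSq ξ →
      Tendsto (fun N : ℕ => joinEntropyIter T N ξ / (N : ℝ)) atTop (𝓝 0) := by
  obtain ⟨n, A, v, hA1, hA2, hA3, hA4, hA5, hA6⟩ := hT
  have hT : IsRectExchange T A v := ⟨hA1, hA2, hA3, hA4, hA5, hA6⟩
  rintro k ξ ⟨hξm, hξd, hξc⟩
  have h0 : ((0 : ℝ), (0 : ℝ)) ∈ unitSq := by simp [unitSq]
  obtain ⟨i₀, -⟩ := Set.mem_iUnion.1 (hξc h0)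
  obtain ⟨j₀, -⟩ := Set.mem_iUnion.1 (hT.iUnion_eq.symm ▸ h0)
  have : Nonempty (Fin k) := ⟨i₀⟩
  obtain ⟨c, hcm, hc⟩ := exists_measurable_code hξm hξd hξc
  simp only [joinEntropyIter_eq_finEntropy hT.bijOn.mapsTo hc]
  refine tendsto_order.2 ⟨fun b hb => Eventually.of_forall fun N =>
    hb.trans_le (div_nonneg (finEntropy_nonneg _ _) N.cast_nonneg), fun ε hε => ?_⟩
  have hk : (0 : ℝ) < k := by exact_mod_cast i₀.pos
  set r := Real.exp (-(ε / 4)) with hr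
  have hr1 : r < 1 := by rw [hr, Real.exp_lt_one_iff]; linarith
  set s := (1 - r) / k with hs
  have hs0 : 0 < s := div_pos (by linarith) hk
  set L := |Real.log s| + 1 with hL
  have hL0 : 0 < L := by positivity
  obtain ⟨δ, hδ, hfine⟩ := exists_fine_code hcm (ε := ε / 4 / L) (by positivity)
  obtain ⟨m, hm⟩ := exists_nat_one_div_lt hδ
  obtain ⟨D, hD, hDd⟩ := hT.exists_refinement (m + 1) m.succ_pos
  have : Nonempty (Fin n × Fin (m + 1) × Fin (m + 1)) := ⟨(j₀, 0, 0)⟩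
  obtain ⟨a, ham, ha⟩ := exists_measurable_code (fun j => (hD.isRect j).measurableSet)
    hD.disjoint hD.iUnion_eq.superset
  have haD : ∀ x ∈ unitSq, x ∈ D (a x) := fun x hx => (ha x hx _).2 rfl
  obtain ⟨e, he⟩ := hfine a fun x hx y hy hxy =>
    (hDd (a x) x (haD x hx) y (hxy ▸ haD y hy)).trans (by exact_mod_cast hm)
  have hlim := tendsto_two_mul_log_one_add_mul_div
    (Fintype.card (Fin n × Fin (m + 1) × Fin (m + 1))) (Nat.cast_nonneg _)
  filter_upwards [(tendsto_order.1 hlim).2 (ε / 4) (by positivity), eventually_ge_atTop 1]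
    with N hN hN1
  have hN0 : (0 : ℝ) < N := by exact_mod_cast hN1
  have h1 := finEntropy_itinerary_le _ hD.measurePreserving hcm ham e (Real.exp_pos _) hr1.le hs0
    (by rw [Fintype.card_fin, hs, mul_div_cancel₀ _ hk.ne']; linarith) N
  have h2 := hD.finEntropy_itinerary_le_log ham haD N
  have h3 : -Real.log s * (volume.restrict unitSq).real {x | c x ≠ e (a x)} ≤ ε / 4 := by
    calc _ ≤ L * (ε / 4 / L) := by
          gcongr
          linarith [neg_le_abs (Real.log s)]
      _ = ε / 4 := mul_div_cancel₀ _ hL0.ne'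
  rw [Real.log_exp, neg_neg] at h1
  rw [div_lt_iff₀ hN0] at hN ⊢
  nlinarith
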